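/- arXiv:2307.13329 — 2 statements merged into one kernel-verified Lean document; each statement's English description precedes it below -/
import Mathlib

section
/- (Estimate (3.2)) Let n = 1, let δ₀ ∈ (0,1) be a fixed number such that |sin θ / θ| ≥ 1/2 for all θ ∈ (0, δ₀], and for t > δ₀ set A(t) = δ₀/√(t² − δ₀²). Then there exist a constant C₀ > 0 and a time T > δ₀ such that for all t ≥ T, ∫_{|ξ| ≤ A(t)} sin²(t f(|ξ|)) / f(|ξ|)² dξ ≥ C₀ t, where the integrand is interpreted as t² at ξ = 0. -/
open MeasureTheory Real Complex

/-- `f(r) = r / sqrt(1 + r^2)`. -/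
noncomputable def fw (r : ℝ) : ℝ := r / Real.sqrt (1 + r ^ 2)

theorem fw_pos {r : ℝ} (hr : 0 < r) : 0 < fw r := by
  unfold fw
  positivity

theorem measurable_fw : Measurable fw := by
  unfold fw
  fun_prop

theorem mul_fw_le {δ t r : ℝ} (hδ : 0 ≤ δ) (ht : δ < t) (hr : 0 ≤ r)
    (h : r ≤ δ / Real.sqrt (t ^ 2 - δ ^ 2)) : t * fw r ≤ δ := by
  have hpos : 0 < t ^ 2 - δ ^ 2 := by nlinarith
  have hsq : r ^ 2 * (t ^ 2 - δ ^ 2) ≤ δ ^ 2 := by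
    rw [le_div_iff₀ (Real.sqrt_pos.2 hpos)] at h
    calc r ^ 2 * (t ^ 2 - δ ^ 2) = (r * Real.sqrt (t ^ 2 - δ ^ 2)) ^ 2 := by
          rw [mul_pow, Real.sq_sqrt hpos.le]
      _ ≤ δ ^ 2 := by gcongr
  have hs : 0 < Real.sqrt (1 + r ^ 2) := by positivity
  rw [fw, ← mul_div_assoc, div_le_iff₀ hs]
  refine abs_le_of_sq_le_sq' ?_ (by positivity) |>.2
  rw [mul_pow, mul_pow, Real.sq_sqrt (by positivity)]
  linarith

theorem sin_mul_sq_div_sq_le {t y : ℝ} (hy : 0 < y) :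
    Real.sin (t * y) ^ 2 / y ^ 2 ≤ t ^ 2 := by
  rw [div_le_iff₀ (by positivity), ← mul_pow]
  exact sq_le_sq.2 Real.abs_sin_le_abs

theorem le_sin_mul_sq_div_sq {t y : ℝ} (ht : 0 < t) (hy : 0 < y)
    (h : (1 : ℝ) / 2 ≤ |Real.sin (t * y) / (t * y)|) :
    t ^ 2 / 4 ≤ Real.sin (t * y) ^ 2 / y ^ 2 := by
  have h2 : ((1 : ℝ) / 2) ^ 2 ≤ (Real.sin (t * y) / (t * y)) ^ 2 := by
    rw [← sq_abs (Real.sin (t * y) / (t * y))]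
    gcongr
  calc t ^ 2 / 4 = ((1 : ℝ) / 2) ^ 2 * t ^ 2 := by ring
    _ ≤ (Real.sin (t * y) / (t * y)) ^ 2 * t ^ 2 := by gcongr
    _ = Real.sin (t * y) ^ 2 / y ^ 2 := by field_simp

open scoped Classical in
/-- Estimate (3.2): for `n = 1`, with `δ₀ ∈ (0,1)` such that `|sin θ / θ| ≥ 1/2` on
`(0, δ₀]` and `A(t) = δ₀/√(t² − δ₀²)`, there are `C₀ > 0` and `T > δ₀` with
`∫_{|ξ| ≤ A(t)} sin²(t f(|ξ|))/f(|ξ|)² dξ ≥ C₀ t` for all `t ≥ T`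
(the integrand being `t²` at `ξ = 0`). -/
theorem estimate_3_2
    (δ₀ : ℝ) (hδ₀ : δ₀ ∈ Set.Ioo (0 : ℝ) 1)
    (hδ : ∀ θ ∈ Set.Ioc (0 : ℝ) δ₀, (1 : ℝ) / 2 ≤ |Real.sin θ / θ|) :
    ∃ C₀ > (0 : ℝ), ∃ T > δ₀, ∀ t ≥ T,
      C₀ * t ≤
        ∫ ξ in {ξ : ℝ | |ξ| ≤ δ₀ / Real.sqrt (t ^ 2 - δ₀ ^ 2)},
          (if ξ = 0 then t ^ 2 else Real.sin (t * fw |ξ|) ^ 2 / fw |ξ| ^ 2) := by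
  obtain ⟨h0, h1⟩ := hδ₀
  refine ⟨δ₀ / 2, by positivity, 1, h1, fun t ht => ?_⟩
  have ht0 : 0 < t := by linarith
  have hδt : δ₀ < t := by linarith
  have hpos : 0 < t ^ 2 - δ₀ ^ 2 := by nlinarith
  have hsqrt : 0 < Real.sqrt (t ^ 2 - δ₀ ^ 2) := Real.sqrt_pos.2 hpos
  set A := δ₀ / Real.sqrt (t ^ 2 - δ₀ ^ 2) with hA
  have hA0 : 0 < A := by positivity
  have hAt : δ₀ / t ≤ A := by
    have : Real.sqrt (t ^ 2 - δ₀ ^ 2) ≤ t := Real.sqrt_le_iff.2 ⟨ht0.le, by nlinarith⟩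
    rw [hA]
    gcongr
  have hset : {ξ : ℝ | |ξ| ≤ A} = Set.Icc (-A) A := by
    ext ξ
    simp [abs_le]
  rw [hset]
  set g : ℝ → ℝ := fun ξ =>
    if ξ = 0 then t ^ 2 else Real.sin (t * fw |ξ|) ^ 2 / fw |ξ| ^ 2 with hg
  have hmeas : Measurable g := by
    have hf : Measurable fun ξ : ℝ => fw |ξ| := measurable_fw.comp measurable_id.abs
    refine Measurable.ite (measurableSet_singleton 0) measurable_const ?_
    fun_prop
  have hlower : ∀ ξ ∈ Set.Icc (-A) A, t ^ 2 / 4 ≤ g ξ := by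
    intro ξ hξ
    by_cases h : ξ = 0
    · simp only [hg, h, if_true]
      nlinarith
    · simp only [hg, h, if_false]
      have hy : 0 < fw |ξ| := fw_pos (abs_pos.2 h)
      exact le_sin_mul_sq_div_sq ht0 hy <| hδ _
        ⟨by positivity, mul_fw_le h0.le hδt (abs_nonneg ξ) (abs_le.2 hξ)⟩
  have hbound : ∀ ξ, ‖g ξ‖ ≤ t ^ 2 := by
    intro ξ
    by_cases h : ξ = 0
    · simp [hg, h]
    · simp only [hg, h, if_false]
      rw [Real.norm_of_nonneg (by positivity)]
      exact sin_mul_sq_div_sq_le (fw_pos (abs_pos.2 h))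
  have hint : IntegrableOn g (Set.Icc (-A) A) :=
    IntegrableOn.of_bound measure_Icc_lt_top hmeas.aestronglyMeasurable (t ^ 2)
      (Filter.Eventually.of_forall hbound)
  calc δ₀ / 2 * t = t ^ 2 / 4 * (2 * (δ₀ / t)) := by
        field_simp
        ring
    _ ≤ t ^ 2 / 4 * (2 * A) := by gcongr
    _ = t ^ 2 / 4 * volume.real (Set.Icc (-A) A) := by
        rw [Real.volume_real_Icc_of_le (by linarith)]
        ring
    _ ≤ ∫ ξ in Set.Icc (-A) A, g ξ :=
        setIntegral_ge_of_const_le_real measurableSet_Icc measure_Icc_lt_top.ne hlower hint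
end

section
/- (Estimates (3.13)–(3.18) combined) Let f(r) = r/√(1+r²), so f'(r) = (1+r²)^{−3/2}. Then there exist a constant C > 0 and a time T > 1 such that for all t ≥ T, |R₁(t)| ≤ C, where R₁(t) := ∫_{1/t}^1 e^{−r²} r^{−1} cos(2 t f(r)) dr. -/
open MeasureTheory Real Complex

theorem hasDerivAt_sqrt_one_add_sq (r : ℝ) :
    HasDerivAt (fun x : ℝ => Real.sqrt (1 + x ^ 2)) (r / Real.sqrt (1 + r ^ 2)) r := by
  have h := ((hasDerivAt_pow 2 r).const_add 1).sqrt (by positivity)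
  refine h.congr_deriv ?_
  have : 0 < Real.sqrt (1 + r ^ 2) := by positivity
  simp only [Nat.cast_ofNat, Nat.add_one_sub_one, pow_one]
  field_simp

theorem hasDerivAt_fw (r : ℝ) : HasDerivAt fw (1 / Real.sqrt (1 + r ^ 2) ^ 3) r := by
  change HasDerivAt (fun x => x / Real.sqrt (1 + x ^ 2)) _ r
  have hs : 0 < Real.sqrt (1 + r ^ 2) := by positivity
  have hsq : Real.sqrt (1 + r ^ 2) ^ 2 = 1 + r ^ 2 := Real.sq_sqrt (by positivity)
  refine ((hasDerivAt_id' r).fun_div (hasDerivAt_sqrt_one_add_sq r) hs.ne').congr_deriv ?_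
  field_simp
  linarith

/-- The amplitude produced by integrating `exp (-r²) r⁻¹ cos (2 t f)` by parts, with `f = fw`. -/
noncomputable def amplitude (r : ℝ) : ℝ :=
  Real.exp (-r ^ 2) * r⁻¹ * Real.sqrt (1 + r ^ 2) ^ 3

/-- The derivative of `amplitude` away from the origin. -/
noncomputable def amplitudeDeriv (r : ℝ) : ℝ :=
  Real.exp (-r ^ 2) * (3 * Real.sqrt (1 + r ^ 2) - 2 * Real.sqrt (1 + r ^ 2) ^ 3
    - Real.sqrt (1 + r ^ 2) ^ 3 * (r ^ 2)⁻¹)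

theorem hasDerivAt_amplitude {r : ℝ} (hr : r ≠ 0) :
    HasDerivAt amplitude (amplitudeDeriv r) r := by
  have hs : 0 < Real.sqrt (1 + r ^ 2) := by positivity
  have h := (((hasDerivAt_id r).pow 2).neg.exp.mul (hasDerivAt_inv hr)).mul
    ((hasDerivAt_sqrt_one_add_sq r).pow 3)
  refine h.congr_deriv ?_
  simp [amplitudeDeriv]
  field_simp
  ring

theorem hasDerivAt_amplitude_mul_sin {r t : ℝ} (hr : r ≠ 0) (ht : t ≠ 0) :
    HasDerivAt (fun x => amplitude x * Real.sin (2 * t * fw x) / (2 * t))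
      (Real.exp (-r ^ 2) * r⁻¹ * Real.cos (2 * t * fw r)
        + amplitudeDeriv r * Real.sin (2 * t * fw r) / (2 * t)) r := by
  have hs : 0 < Real.sqrt (1 + r ^ 2) := by positivity
  have h := ((hasDerivAt_amplitude hr).mul
    (((hasDerivAt_fw r).const_mul (2 * t)).sin)).div_const (2 * t)
  refine h.congr_deriv ?_
  simp only [amplitude]
  field_simp
  ring

theorem sqrt_one_add_sq_pow_three_le {r : ℝ} (hr : 0 ≤ r) (hr1 : r ≤ 1) :
    Real.sqrt (1 + r ^ 2) ≤ 2 ∧ Real.sqrt (1 + r ^ 2) ^ 3 ≤ 4 := by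
  have hsq : Real.sqrt (1 + r ^ 2) ^ 2 = 1 + r ^ 2 := Real.sq_sqrt (by positivity)
  have hs : 0 ≤ Real.sqrt (1 + r ^ 2) := Real.sqrt_nonneg _
  have h2 : Real.sqrt (1 + r ^ 2) ≤ 2 := by nlinarith
  exact ⟨h2, by nlinarith⟩

theorem exp_neg_sq_le_one (r : ℝ) : Real.exp (-r ^ 2) ≤ 1 :=
  Real.exp_le_one_iff.2 (neg_nonpos.2 (sq_nonneg r))

theorem abs_amplitude_le {r : ℝ} (hr : 0 < r) (hr1 : r ≤ 1) : |amplitude r| ≤ 4 * r⁻¹ := by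
  have h := (sqrt_one_add_sq_pow_three_le hr.le hr1).2
  rw [abs_of_nonneg (by unfold amplitude; positivity)]
  calc amplitude r ≤ 1 * r⁻¹ * 4 := by
        unfold amplitude
        gcongr
        exact exp_neg_sq_le_one r
    _ = 4 * r⁻¹ := by ring

theorem abs_amplitudeDeriv_le {r : ℝ} (hr : 0 < r) (hr1 : r ≤ 1) :
    |amplitudeDeriv r| ≤ 18 * (r ^ 2)⁻¹ := by
  obtain ⟨h2, h3⟩ := sqrt_one_add_sq_pow_three_le hr.le hr1
  have hs : 0 ≤ Real.sqrt (1 + r ^ 2) := Real.sqrt_nonneg _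
  have hs3 : 0 ≤ Real.sqrt (1 + r ^ 2) ^ 3 := by positivity
  have hinv : 1 ≤ (r ^ 2)⁻¹ := (one_le_inv₀ (by positivity)).2 (pow_le_one₀ hr.le hr1)
  have hm : Real.sqrt (1 + r ^ 2) ^ 3 * (r ^ 2)⁻¹ ≤ 4 * (r ^ 2)⁻¹ := by gcongr
  have hm0 : 0 ≤ Real.sqrt (1 + r ^ 2) ^ 3 * (r ^ 2)⁻¹ := by positivity
  rw [amplitudeDeriv, abs_mul, Real.abs_exp, ← one_mul (18 * (r ^ 2)⁻¹)]
  refine mul_le_mul (exp_neg_sq_le_one r) ?_ (abs_nonneg _) zero_le_one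
  rw [abs_le]
  constructor <;> linarith

theorem abs_amplitude_mul_sin_le {r t : ℝ} (hr : 0 < r) (hr1 : r ≤ 1) (ht : 0 < t) (x : ℝ) :
    |amplitude r * Real.sin x / (2 * t)| ≤ 2 * (r⁻¹ / t) := by
  rw [abs_div, abs_mul, abs_of_pos (by positivity : 0 < 2 * t)]
  calc |amplitude r| * |Real.sin x| / (2 * t) ≤ 4 * r⁻¹ * 1 / (2 * t) := by
        gcongr
        · exact abs_amplitude_le hr hr1
        · exact Real.abs_sin_le_one x
    _ = 2 * (r⁻¹ / t) := by field_simp; norm_num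

theorem abs_amplitudeDeriv_mul_sin_le {r t : ℝ} (hr : 0 < r) (hr1 : r ≤ 1) (ht : 0 < t) (x : ℝ) :
    |amplitudeDeriv r * Real.sin x / (2 * t)| ≤ 9 / t * (r ^ 2)⁻¹ := by
  rw [abs_div, abs_mul, abs_of_pos (by positivity : 0 < 2 * t)]
  calc |amplitudeDeriv r| * |Real.sin x| / (2 * t) ≤ 18 * (r ^ 2)⁻¹ * 1 / (2 * t) := by
        gcongr
        · exact abs_amplitudeDeriv_le hr hr1
        · exact Real.abs_sin_le_one x
    _ = 9 / t * (r ^ 2)⁻¹ := by field_simp; norm_num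

theorem integral_inv_sq {a b : ℝ} (ha : 0 < a) (hab : a ≤ b) :
    ∫ r in a..b, (r ^ 2)⁻¹ = a⁻¹ - b⁻¹ := by
  have hpos : ∀ r ∈ Set.uIcc a b, r ≠ 0 := fun r hr => by
    rw [Set.uIcc_of_le hab] at hr
    exact (ha.trans_le hr.1).ne'
  rw [intervalIntegral.integral_eq_sub_of_hasDerivAt (f := fun r => -r⁻¹)]
  · ring
  · intro r hr
    exact (hasDerivAt_inv (hpos r hr)).neg.congr_deriv (by simp)
  · refine ContinuousOn.intervalIntegrable ?_
    exact ContinuousOn.inv₀ (by fun_prop) fun r hr => pow_ne_zero 2 (hpos r hr)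

/-- Estimates (3.13)–(3.18) combined: there are `C > 0` and `T > 1` such that for all
`t ≥ T`, `|R₁(t)| ≤ C` where `R₁(t) = ∫_{1/t}^1 e^{−r²} r⁻¹ cos(2 t f(r)) dr`. -/
theorem estimate_R1_bounded :
    ∃ C > (0 : ℝ), ∃ T > (1 : ℝ), ∀ t ≥ T,
      |∫ r in (1/t : ℝ)..1, Real.exp (-r ^ 2) * r⁻¹ * Real.cos (2 * t * fw r)| ≤ C := by
  refine ⟨13, by norm_num, 2, by norm_num, fun t ht => ?_⟩
  have ht0 : 0 < t := by linarith
  have ha : 0 < 1 / t := by positivity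
  have ha1 : 1 / t ≤ 1 := by rw [div_le_one ht0]; linarith
  have hne : ∀ r ∈ Set.uIcc (1 / t) 1, r ≠ 0 := fun r hr => by
    rw [Set.uIcc_of_le ha1] at hr
    exact (ha.trans_le hr.1).ne'
  have hfw : Continuous fw :=
    continuous_iff_continuousAt.2 fun r => (hasDerivAt_fw r).continuousAt
  have hinv : ContinuousOn (fun r : ℝ => r⁻¹) (Set.uIcc (1 / t) 1) :=
    continuousOn_id.inv₀ hne
  have hinv2 : ContinuousOn (fun r : ℝ => (r ^ 2)⁻¹) (Set.uIcc (1 / t) 1) :=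
    ContinuousOn.inv₀ (by fun_prop) fun r hr => pow_ne_zero 2 (hne r hr)
  have hI : IntervalIntegrable
      (fun r => Real.exp (-r ^ 2) * r⁻¹ * Real.cos (2 * t * fw r)) volume (1 / t) 1 :=
    ContinuousOn.intervalIntegrable (by fun_prop)
  have hJ : IntervalIntegrable
      (fun r => amplitudeDeriv r * Real.sin (2 * t * fw r) / (2 * t)) volume (1 / t) 1 := by
    refine ContinuousOn.intervalIntegrable ?_
    unfold amplitudeDeriv
    fun_prop
  have hparts := intervalIntegral.integral_eq_sub_of_hasDerivAt
    (fun r hr => hasDerivAt_amplitude_mul_sin (hne r hr) ht0.ne') (hI.add hJ)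
  rw [intervalIntegral.integral_add hI hJ] at hparts
  have hrem : |∫ r in (1 / t)..1, amplitudeDeriv r * Real.sin (2 * t * fw r) / (2 * t)| ≤ 9 := by
    calc _ ≤ ∫ r in (1 / t)..1, 9 / t * (r ^ 2)⁻¹ := by
          rw [← Real.norm_eq_abs]
          refine intervalIntegral.norm_integral_le_of_norm_le ha1 ?_
            (hinv2.intervalIntegrable.const_mul _)
          refine Filter.Eventually.of_forall fun r hr => ?_
          exact abs_amplitudeDeriv_mul_sin_le (ha.trans hr.1) hr.2 ht0 _
      _ = 9 - 9 / t := by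
          rw [intervalIntegral.integral_const_mul, integral_inv_sq ha ha1]
          field_simp
      _ ≤ 9 := sub_le_self _ (by positivity)
  have hend := abs_amplitude_mul_sin_le one_pos le_rfl ht0 (2 * t * fw 1)
  have hstart := abs_amplitude_mul_sin_le ha ha1 ht0 (2 * t * fw (1 / t))
  have hone : (1 : ℝ)⁻¹ / t ≤ 1 := by simpa using ha1
  have htt : (1 / t)⁻¹ / t = 1 := by field_simp
  rw [htt] at hstart
  rw [abs_le] at hrem hend hstart ⊢
  constructor <;> linarith [hrem.1, hrem.2, hend.1, hend.2, hstart.1, hstart.2]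
end
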